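/- Let A be an m×n matrix over 𝔼 and r a natural number. Suppose A has a zeroless minor of order r, and there exists a representative matrix Â of A whose rank over the field ℝ* equals r (i.e., the strict rank sr(A) = r is defined). Then mr(A) = r and r(A) = r. -/

import Mathlib

open scoped Pointwise Classical

noncomputable section

-- Note: `ℝ*` is Mathlib's notation for the hyperreals `Hyperreal`.

/-- A neutrix: an order-convex additive subgroup of the hyperreals. -/
def IsNeutrix (A : Set ℝ*) : Prop :=
  (0 : ℝ*) ∈ A ∧ (∀ x ∈ A, ∀ y ∈ A, x + y ∈ A) ∧ (∀ x ∈ A, -x ∈ A) ∧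
    ∀ x ∈ A, ∀ y ∈ A, ∀ z : ℝ*, x ≤ z → z ≤ y → z ∈ A

/-- The coset `a + A`. -/
def coset (a : ℝ*) (A : Set ℝ*) : Set ℝ* := {x | ∃ u ∈ A, x = a + u}

/-- `α` is an external number: a coset of a neutrix. -/
def IsExt (α : Set ℝ*) : Prop := ∃ a A, IsNeutrix A ∧ α = coset a A

/-- The neutrix part `N(α)` of an external number, as the set of differences. -/
def Nx (α : Set ℝ*) : Set ℝ* := {d | ∃ x ∈ α, ∃ y ∈ α, d = x - y}

/-- An external number is zeroless if it does not contain `0`. -/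
def Zeroless (α : Set ℝ*) : Prop := (0 : ℝ*) ∉ α

/-- Multiplication of external numbers: `αβ = ab + aB + bA + AB`
(independent of the chosen representatives). -/
def emul (α β : Set ℝ*) : Set ℝ* :=
  {z | ∃ a A b B, IsNeutrix A ∧ IsNeutrix B ∧ α = coset a A ∧ β = coset b B ∧
      ∃ u ∈ A, ∃ v ∈ B, ∃ u' ∈ A, ∃ v' ∈ B, z = a * b + a * v + b * u + u' * v'}

/-- Multiplication of an external number by a hyperreal scalar: `t·α = ta + tA`. -/
def esmul (t : ℝ*) (α : Set ℝ*) : Set ℝ* := (fun x => t * x) '' α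

/-- Inverse of a (zeroless) external number: `1/α = 1/a + A/a²`. -/
def einv (α : Set ℝ*) : Set ℝ* :=
  {z | ∃ a A, IsNeutrix A ∧ α = coset a A ∧ ∃ u ∈ A, z = a⁻¹ + u / a ^ 2}

/-- Division of external numbers: `α/β = α · (1/β)`. -/
def ediv (α β : Set ℝ*) : Set ℝ* := emul α (einv β)

/-- The neutrix `⊘` of infinitesimal hyperreals. -/
def oslash : Set ℝ* := {x | Hyperreal.Infinitesimal x}

/-- Relative uncertainty `R(α)`: `A/a` if `α = a + A` is zeroless,
and all of `ℝ*` if `α` is a neutrix. -/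
def RU (α : Set ℝ*) : Set ℝ* :=
  if (0 : ℝ*) ∈ α then Set.univ
  else {z | ∃ a A, IsNeutrix A ∧ α = coset a A ∧ ∃ u ∈ A, z = u / a}

/-- `α` and `β` are nearly opposite: both zeroless and `α/β ⊆ -1 + ⊘`. -/
def NearlyOpposite (α β : Set ℝ*) : Prop :=
  Zeroless α ∧ Zeroless β ∧ ediv α β ⊆ coset (-1) oslash

/-- Order on external numbers: `α ≤ β` iff `∀ x ∈ α, ∃ y ∈ β, x ≤ y`. -/
def ele (α β : Set ℝ*) : Prop := ∀ x ∈ α, ∃ y ∈ β, x ≤ y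

/-- `α` is non-negative: some element of `α` is `≥ 0`. -/
def eNonneg (α : Set ℝ*) : Prop := ∃ x ∈ α, (0 : ℝ*) ≤ x

/-- Absolute value of an external number: `|α| = |a| + A`. -/
def eabs (α : Set ℝ*) : Set ℝ* :=
  {z | ∃ a A, IsNeutrix A ∧ α = coset a A ∧ ∃ u ∈ A, z = |a| + u}

/-- Product of a finite family of external numbers. -/
def eprod : ∀ {n : ℕ}, (Fin n → Set ℝ*) → Set ℝ*
  | 0, _ => {1}
  | _ + 1, f => emul (f 0) (eprod fun i => f i.succ)

/-- Power of an external number. -/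
def epow (α : Set ℝ*) : ℕ → Set ℝ*
  | 0 => {1}
  | k + 1 => emul α (epow α k)

/-- Matrix product over external numbers: `(AB)_{ij} = Σ_k α_{ik}β_{kj}`. -/
def matMul {m n p : ℕ} (M : Matrix (Fin m) (Fin n) (Set ℝ*))
    (N : Matrix (Fin n) (Fin p) (Set ℝ*)) : Matrix (Fin m) (Fin p) (Set ℝ*) :=
  fun i j => ∑ k, emul (M i k) (N k j)

/-- Entrywise (Minkowski) sum of matrices over external numbers. -/
def matAdd {m n : ℕ} (M N : Matrix (Fin m) (Fin n) (Set ℝ*)) :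
    Matrix (Fin m) (Fin n) (Set ℝ*) := fun i j => M i j + N i j

/-- Entrywise scalar multiple of a matrix by an external number. -/
def matSmul {m n : ℕ} (α : Set ℝ*) (M : Matrix (Fin m) (Fin n) (Set ℝ*)) :
    Matrix (Fin m) (Fin n) (Set ℝ*) := fun i j => emul α (M i j)

/-- Entrywise inclusion of matrices over external numbers. -/
def matIncl {m n : ℕ} (M N : Matrix (Fin m) (Fin n) (Set ℝ*)) : Prop :=
  ∀ i j, M i j ⊆ N i j

/-- Determinant of a square matrix over the external numbers. -/
def detE {n : ℕ} (M : Matrix (Fin n) (Fin n) (Set ℝ*)) : Set ℝ* :=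
  ∑ σ : Equiv.Perm (Fin n),
    esmul ((Equiv.Perm.sign σ : ℤ) : ℝ*) (eprod fun i => M i (σ i))

/-- The `(i,j)` minor of a square matrix over the external numbers. -/
def minorE {n : ℕ} (M : Matrix (Fin (n + 1)) (Fin (n + 1)) (Set ℝ*))
    (i j : Fin (n + 1)) : Set ℝ* :=
  detE (M.submatrix i.succAbove j.succAbove)

/-- The near-identity matrix `I_n(N)`: diagonal entries `1 + N`, off-diagonal entries `N`. -/
def Iun (n : ℕ) (N : Set ℝ*) : Matrix (Fin n) (Fin n) (Set ℝ*) :=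
  fun i j => if i = j then coset 1 N else N

/-- A finite family of vectors of external numbers is linearly dependent:
some nontrivial real (hyperreal) linear combination is a neutrix vector. -/
def LinDepE {ι : Type*} [Fintype ι] {n : ℕ} (ξ : ι → Fin n → Set ℝ*) : Prop :=
  ∃ t : ι → ℝ*, (∃ i, t i ≠ 0) ∧ ∃ A : Fin n → Set ℝ*,
    (∀ j, IsNeutrix (A j)) ∧ ∀ j, (∑ i, esmul (t i) (ξ i j)) = A j

/-- The matrix has a zeroless minor of order `k`. -/
def HasZerolessMinor {m n : ℕ} (M : Matrix (Fin m) (Fin n) (Set ℝ*)) (k : ℕ) : Prop :=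
  ∃ (f : Fin k → Fin m) (g : Fin k → Fin n), Function.Injective f ∧ Function.Injective g ∧
    Zeroless (detE fun i j => M (f i) (g j))

/-- The minor rank of `M` is `r`. -/
def minorRankIs {m n : ℕ} (M : Matrix (Fin m) (Fin n) (Set ℝ*)) (r : ℕ) : Prop :=
  HasZerolessMinor M r ∧ ∀ k, HasZerolessMinor M k → k ≤ r

/-- The row rank of `M` is `r`: the maximal cardinality of a linearly
independent set of row vectors of `M` is `r`. -/
def rowRankIs {m n : ℕ} (M : Matrix (Fin m) (Fin n) (Set ℝ*)) (r : ℕ) : Prop :=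
  (∃ s : Finset (Fin m), s.card = r ∧ ¬ LinDepE fun (i : {x // x ∈ s}) j => M i.1 j) ∧
  ∀ s : Finset (Fin m), (¬ LinDepE fun (i : {x // x ∈ s}) j => M i.1 j) → s.card ≤ r

/-- `M` is a reduced matrix: `max_{i,j} |α_{ij}| = 1 + A₀` for some neutrix `A₀ ⊆ ⊘`. -/
def IsReducedMat {m n : ℕ} (M : Matrix (Fin m) (Fin n) (Set ℝ*)) : Prop :=
  ∃ A₀, IsNeutrix A₀ ∧ A₀ ⊆ oslash ∧ (∃ i j, eabs (M i j) = coset 1 A₀) ∧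
    ∀ i j, ele (eabs (M i j)) (coset 1 A₀)

/-- Criterion for a neutrix: a solid set closed under addition and containing `0`. -/
theorem isNeutrix_of_solid {A : Set ℝ*} (h0 : (0 : ℝ*) ∈ A)
    (hadd : ∀ x ∈ A, ∀ y ∈ A, x + y ∈ A)
    (hsolid : ∀ y ∈ A, ∀ z : ℝ*, |z| ≤ |y| → z ∈ A) : IsNeutrix A := by
  refine ⟨h0, hadd, fun x hx => hsolid x hx _ (abs_neg x).le, fun x hx y hy z hxz hzy => ?_⟩
  rcases le_total 0 z with hz | hz
  · exact hsolid y hy z (abs_le_abs_of_nonneg hz hzy)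
  · exact hsolid x hx z (abs_le_abs_of_nonpos hz hxz)

theorem IsNeutrix.abs_mem {A : Set ℝ*} (hA : IsNeutrix A) {x : ℝ*} (hx : x ∈ A) : |x| ∈ A := by
  rcases abs_choice x with h | h <;> rw [h]
  exacts [hx, hA.2.2.1 x hx]

theorem IsNeutrix.solid {A : Set ℝ*} (hA : IsNeutrix A) {y z : ℝ*} (hy : y ∈ A)
    (h : |z| ≤ |y|) : z ∈ A :=
  hA.2.2.2 _ (hA.2.2.1 _ (hA.abs_mem hy)) _ (hA.abs_mem hy) z (abs_le.mp h).1 (abs_le.mp h).2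

theorem IsNeutrix.add {A B : Set ℝ*} (hA : IsNeutrix A) (hB : IsNeutrix B) :
    IsNeutrix (A + B) := by
  refine isNeutrix_of_solid ⟨0, hA.1, 0, hB.1, add_zero 0⟩ ?_ ?_
  · rintro _ ⟨u, hu, v, hv, rfl⟩ _ ⟨u', hu', v', hv', rfl⟩
    exact ⟨u + u', hA.2.1 _ hu _ hu', v + v', hB.2.1 _ hv _ hv', add_add_add_comm u u' v v'⟩
  · rintro _ ⟨u, hu, v, hv, rfl⟩ z hz
    have hz' : |z| ≤ |u| + |v| := hz.trans (abs_add_le u v)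
    rcases (add_nonneg (abs_nonneg u) (abs_nonneg v)).eq_or_lt with h | h
    · rw [← h] at hz'
      rw [abs_nonpos_iff.mp hz']
      exact ⟨0, hA.1, 0, hB.1, add_zero 0⟩
    · have hc : |z / (|u| + |v|)| ≤ 1 := by
        rw [abs_div, abs_of_pos h]
        exact div_le_one_of_le₀ hz' h.le
      refine ⟨z / (|u| + |v|) * |u|, hA.solid hu ?_, z / (|u| + |v|) * |v|, hB.solid hv ?_, ?_⟩
      · rw [abs_mul, abs_abs]
        exact mul_le_of_le_one_left (abs_nonneg _) hc
      · rw [abs_mul, abs_abs]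
        exact mul_le_of_le_one_left (abs_nonneg _) hc
      · change z / (|u| + |v|) * |u| + z / (|u| + |v|) * |v| = z
        rw [← mul_add, div_mul_cancel₀ _ h.ne']

theorem IsNeutrix.mul {A B : Set ℝ*} (hA : IsNeutrix A) (hB : IsNeutrix B) :
    IsNeutrix (A * B) := by
  have hsolid : ∀ y ∈ A * B, ∀ z : ℝ*, |z| ≤ |y| → z ∈ A * B := by
    rintro _ ⟨u, hu, v, hv, rfl⟩ z hz
    change |z| ≤ |u * v| at hz
    rw [abs_mul] at hz
    rcases eq_or_ne v 0 with rfl | h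
    · rw [abs_zero, mul_zero] at hz
      rw [abs_nonpos_iff.mp hz]
      exact ⟨0, hA.1, 0, hB.1, mul_zero 0⟩
    · refine ⟨z / v, hA.solid hu ?_, v, hv, div_mul_cancel₀ _ h⟩
      rw [abs_div]
      exact div_le_of_le_mul₀ (abs_nonneg _) (abs_nonneg _) hz
  refine isNeutrix_of_solid ⟨0, hA.1, 0, hB.1, mul_zero 0⟩ ?_ hsolid
  rintro _ ⟨u, hu, v, hv, rfl⟩ _ ⟨u', hu', v', hv', rfl⟩
  have hU : max |u| |u'| ∈ A := by
    rcases max_choice |u| |u'| with h | h <;> rw [h]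
    exacts [hA.abs_mem hu, hA.abs_mem hu']
  have hV : max |v| |v'| ∈ B := by
    rcases max_choice |v| |v'| with h | h <;> rw [h]
    exacts [hB.abs_mem hv, hB.abs_mem hv']
  refine hsolid _ (Set.mul_mem_mul (hA.2.1 _ hU _ hU) hV) _ ?_
  refine le_trans ?_ (le_abs_self _)
  change |u * v + u' * v'| ≤ _
  refine (abs_add_le _ _).trans ?_
  rw [abs_mul, abs_mul, add_mul]
  gcongr
  exacts [le_max_left _ _, le_max_left _ _, le_max_right _ _, le_max_right _ _]

theorem IsNeutrix.esmul {A : Set ℝ*} (hA : IsNeutrix A) (t : ℝ*) : IsNeutrix (esmul t A) := by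
  refine isNeutrix_of_solid ⟨0, hA.1, mul_zero t⟩ ?_ ?_
  · rintro _ ⟨u, hu, rfl⟩ _ ⟨v, hv, rfl⟩
    exact ⟨u + v, hA.2.1 _ hu _ hv, mul_add t u v⟩
  · rintro _ ⟨u, hu, rfl⟩ z hz
    change |z| ≤ |t * u| at hz
    rw [abs_mul] at hz
    rcases eq_or_ne t 0 with rfl | h
    · rw [abs_zero, zero_mul] at hz
      rw [abs_nonpos_iff.mp hz]
      exact ⟨0, hA.1, mul_zero 0⟩
    · refine ⟨z / t, hA.solid hu ?_, mul_div_cancel₀ _ h⟩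
      rw [abs_div]
      exact div_le_of_le_mul₀ (abs_nonneg _) (abs_nonneg _) (by rwa [mul_comm] at hz)

theorem isNeutrix_zero : IsNeutrix (0 : Set ℝ*) := by
  refine isNeutrix_of_solid rfl ?_ ?_
  · rintro _ rfl _ rfl
    exact add_zero 0
  · rintro _ rfl z hz
    rw [abs_zero] at hz
    exact abs_nonpos_iff.mp hz

theorem isExt_singleton (a : ℝ*) : IsExt {a} := by
  refine ⟨a, 0, isNeutrix_zero, ?_⟩
  ext x
  simp [coset]

theorem IsExt.add {α β : Set ℝ*} (hα : IsExt α) (hβ : IsExt β) : IsExt (α + β) := by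
  obtain ⟨a, A, hA, rfl⟩ := hα
  obtain ⟨b, B, hB, rfl⟩ := hβ
  refine ⟨a + b, A + B, hA.add hB, ?_⟩
  ext x
  constructor
  · rintro ⟨_, ⟨u, hu, rfl⟩, _, ⟨v, hv, rfl⟩, rfl⟩
    exact ⟨u + v, Set.add_mem_add hu hv, add_add_add_comm a u b v⟩
  · rintro ⟨_, ⟨u, hu, v, hv, rfl⟩, rfl⟩
    exact ⟨a + u, ⟨u, hu, rfl⟩, b + v, ⟨v, hv, rfl⟩, add_add_add_comm a u b v⟩

theorem IsExt.esmul {α : Set ℝ*} (hα : IsExt α) (t : ℝ*) : IsExt (esmul t α) := by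
  obtain ⟨a, A, hA, rfl⟩ := hα
  refine ⟨t * a, _, hA.esmul t, ?_⟩
  ext x
  constructor
  · rintro ⟨_, ⟨u, hu, rfl⟩, rfl⟩
    exact ⟨t * u, ⟨u, hu, rfl⟩, mul_add t a u⟩
  · rintro ⟨_, ⟨u, hu, rfl⟩, rfl⟩
    exact ⟨a + u, ⟨u, hu, rfl⟩, mul_add t a u⟩

theorem IsExt.sum {ι : Type*} (s : Finset ι) {f : ι → Set ℝ*} (hf : ∀ i ∈ s, IsExt (f i)) :
    IsExt (∑ i ∈ s, f i) :=
  Finset.sum_induction f IsExt (fun _ _ => IsExt.add) (isExt_singleton 0) hf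

/-- The neutrix of a coset is determined by the coset, and any two representatives
differ by an element of it. -/
theorem coset_eq_coset {a b : ℝ*} {A B : Set ℝ*} (hA : IsNeutrix A) (hB : IsNeutrix B)
    (h : coset a A = coset b B) : A = B ∧ b - a ∈ A := by
  have hsub : ∀ {a b : ℝ*} {A B : Set ℝ*}, IsNeutrix A → IsNeutrix B →
      coset a A = coset b B → A ⊆ B := by
    intro a b A B hA hB h u hu
    obtain ⟨v, hv, hav⟩ : a + u ∈ coset b B := h ▸ ⟨u, hu, rfl⟩
    obtain ⟨w, hw, haw⟩ : a ∈ coset b B := h ▸ ⟨0, hA.1, (add_zero a).symm⟩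
    have : u = v + -w := by linear_combination hav - haw
    exact this ▸ hB.2.1 _ hv _ (hB.2.2.1 _ hw)
  refine ⟨(hsub hA hB h).antisymm (hsub hB hA h.symm), ?_⟩
  obtain ⟨w, hw, hbw⟩ : b ∈ coset a A := h ▸ ⟨0, hB.1, (add_zero b).symm⟩
  rwa [hbw, add_sub_cancel_left]

theorem emul_coset {a b : ℝ*} {A B : Set ℝ*} (hA : IsNeutrix A) (hB : IsNeutrix B) :
    emul (coset a A) (coset b B) = coset (a * b) (esmul a B + esmul b A + A * B) := by
  ext z
  constructor
  · rintro ⟨a', A', b', B', hA', hB', hα, hβ, u, hu, v, hv, u', hu', v', hv', rfl⟩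
    obtain ⟨rfl, hp⟩ := coset_eq_coset hA hA' hα
    obtain ⟨rfl, hq⟩ := coset_eq_coset hB hB' hβ
    have hAB := (hA.mul hB).2.1
    refine ⟨_, Set.add_mem_add (Set.add_mem_add ⟨_, hB.2.1 _ hq _ hv, rfl⟩
      ⟨_, hA.2.1 _ hp _ hu, rfl⟩) (hAB _ (hAB _ (Set.mul_mem_mul hp (hB.2.1 _ hq _ hv)) _
        (Set.mul_mem_mul hu hq)) _ (Set.mul_mem_mul hu' hv')), ?_⟩
    ring
  · rintro ⟨_, ⟨_, ⟨_, ⟨v, hv, rfl⟩, _, ⟨u, hu, rfl⟩, rfl⟩, _, ⟨u', hu', v', hv', rfl⟩, rfl⟩, rfl⟩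
    refine ⟨a, A, b, B, hA, hB, rfl, rfl, u, hu, v, hv, u', hu', v', hv', ?_⟩
    change a * b + (a * v + b * u + u' * v') = _
    ring

theorem IsExt.emul {α β : Set ℝ*} (hα : IsExt α) (hβ : IsExt β) : IsExt (emul α β) := by
  obtain ⟨a, A, hA, rfl⟩ := hα
  obtain ⟨b, B, hB, rfl⟩ := hβ
  exact ⟨_, _, ((hB.esmul a).add (hA.esmul b)).add (hA.mul hB), emul_coset hA hB⟩

theorem mul_mem_emul {α β : Set ℝ*} (hα : IsExt α) (hβ : IsExt β) {x y : ℝ*}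
    (hx : x ∈ α) (hy : y ∈ β) : x * y ∈ emul α β := by
  obtain ⟨a, A, hA, rfl⟩ := hα
  obtain ⟨b, B, hB, rfl⟩ := hβ
  obtain ⟨u, hu, rfl⟩ := hx
  obtain ⟨v, hv, rfl⟩ := hy
  exact ⟨a, A, b, B, hA, hB, rfl, rfl, u, hu, v, hv, u, hu, v, hv, by ring⟩

theorem isExt_eprod : ∀ {n : ℕ} {f : Fin n → Set ℝ*}, (∀ i, IsExt (f i)) → IsExt (eprod f)
  | 0, _, _ => isExt_singleton 1
  | _ + 1, _, hf => (hf 0).emul (isExt_eprod fun i => hf i.succ)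

theorem prod_mem_eprod : ∀ {n : ℕ} {f : Fin n → Set ℝ*} {x : Fin n → ℝ*},
    (∀ i, IsExt (f i)) → (∀ i, x i ∈ f i) → ∏ i, x i ∈ eprod f
  | 0, _, _, _, _ => Fin.prod_univ_zero _
  | _ + 1, _, x, hf, hx => by
    rw [Fin.prod_univ_succ]
    exact mul_mem_emul (hf 0) (isExt_eprod fun i => hf i.succ) (hx 0)
      (prod_mem_eprod (fun i => hf i.succ) fun i => hx i.succ)

/-- The determinant of a representative matrix represents the determinant. -/
theorem det_mem_detE {n : ℕ} {M : Matrix (Fin n) (Fin n) (Set ℝ*)} (hM : ∀ i j, IsExt (M i j))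
    {X : Matrix (Fin n) (Fin n) ℝ*} (hX : ∀ i j, X i j ∈ M i j) : X.det ∈ detE M := by
  rw [← Matrix.det_transpose, Matrix.det_apply']
  exact Set.finsetSum_mem_finsetSum _ _ _ fun σ _ =>
    ⟨_, prod_mem_eprod (fun i => hM i (σ i)) (fun i => hX i (σ i)), rfl⟩

theorem IsExt.isNeutrix_of_zero_mem {α : Set ℝ*} (hα : IsExt α) (h : (0 : ℝ*) ∈ α) :
    IsNeutrix α := by
  obtain ⟨a, A, hA, rfl⟩ := hα
  obtain ⟨u, hu, h0⟩ := h
  have : coset a A = A := by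
    ext x
    constructor
    · rintro ⟨v, hv, rfl⟩
      have : a + v = -u + v := by linear_combination -h0
      exact this ▸ hA.2.1 _ (hA.2.2.1 _ hu) _ hv
    · exact fun hx => ⟨u + x, hA.2.1 _ hu _ hx, by linear_combination h0⟩
  rwa [this]

/-- Vectors of external numbers are dependent exactly when they admit linearly dependent
representatives. -/
theorem linDepE_iff {ι : Type*} {_ : Fintype ι} {n : ℕ} {ξ : ι → Fin n → Set ℝ*}
    (hξ : ∀ i j, IsExt (ξ i j)) :
    LinDepE ξ ↔ ∃ X : ι → Fin n → ℝ*, (∀ i j, X i j ∈ ξ i j) ∧ ¬ LinearIndependent ℝ* X := by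
  constructor
  · rintro ⟨t, ⟨i₀, hi₀⟩, N, hN, hsum⟩
    have h0 (j : Fin n) : ∃ x : ι → ℝ*, (∀ i, x i ∈ ξ i j) ∧ ∑ i, t i * x i = 0 := by
      have : (0 : ℝ*) ∈ ∑ i, esmul (t i) (ξ i j) := hsum j ▸ (hN j).1
      obtain ⟨g, hg, hg0⟩ := (Set.mem_fintype_sum _ _).mp this
      choose x hx hxg using hg
      exact ⟨x, hx, by rw [← hg0]; exact Finset.sum_congr rfl fun i _ => hxg i⟩
    choose x hx hx0 using h0
    refine ⟨fun i j => x j i, fun i j => hx j i, ?_⟩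
    rw [Fintype.not_linearIndependent_iff]
    exact ⟨t, funext fun j => by simpa using hx0 j, i₀, hi₀⟩
  · rintro ⟨X, hX, hdep⟩
    obtain ⟨t, ht, hne⟩ := Fintype.not_linearIndependent_iff.mp hdep
    refine ⟨t, hne, _, fun j => ?_, fun j => rfl⟩
    refine (IsExt.sum _ fun i _ => (hξ i j).esmul (t i)).isNeutrix_of_zero_mem ?_
    have h0 : ∑ i, t i * X i j = 0 := by simpa using congrFun ht j
    rw [← h0]
    exact Set.finsetSum_mem_finsetSum _ _ _ fun i _ => ⟨_, hX i j, rfl⟩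

theorem stmt18 {m n : ℕ} (A : Matrix (Fin m) (Fin n) (Set ℝ*)) (hA : ∀ i j, IsExt (A i j))
    (r : ℕ) (hminor : HasZerolessMinor A r)
    (hrep : ∃ Ahat : Matrix (Fin m) (Fin n) ℝ*,
      (∀ i j, Ahat i j ∈ A i j) ∧ Ahat.rank = r) :
    minorRankIs A r ∧ rowRankIs A r := by
  obtain ⟨X, hX, hrank⟩ := hrep
  refine ⟨⟨hminor, ?_⟩, ?_, ?_⟩
  · rintro k ⟨f, g, -, -, hz⟩
    have hdet : (X.submatrix f g).det ≠ 0 := fun h =>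
      hz (h ▸ det_mem_detE (fun i j => hA (f i) (g j)) fun i j => hX (f i) (g j))
    have hk : (X.submatrix f g).rank = k := by
      rw [Matrix.rank_of_isUnit _ ((Matrix.isUnit_iff_isUnit_det _).mpr hdet.isUnit),
        Fintype.card_fin]
    rw [← hk, ← hrank]
    exact Matrix.rank_submatrix_le _ _ _
  · obtain ⟨f, g, hf, -, hz⟩ := hminor
    refine ⟨Finset.univ.image f, by simp [Finset.card_image_of_injective _ hf], fun hdep => hz ?_⟩
    obtain ⟨Y, hY, hdepY⟩ := (linDepE_iff fun _ _ => hA _ _).mp hdep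
    let e : Fin r → {x // x ∈ Finset.univ.image f} := fun i =>
      ⟨f i, Finset.mem_image_of_mem f (Finset.mem_univ i)⟩
    have he : Function.Bijective e := by
      refine ⟨fun i j h => hf (congrArg Subtype.val h), ?_⟩
      rintro ⟨x, hx⟩
      obtain ⟨i, -, rfl⟩ := Finset.mem_image.mp hx
      exact ⟨i, rfl⟩
    have hdet : (Matrix.of fun i j => Y (e i) (g j)).det = 0 := by
      by_contra hne
      apply hdepY
      have hrows := Matrix.linearIndependent_rows_of_det_ne_zero hne
      have hcomp : LinearIndependent ℝ* (Y ∘ e) :=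
        hrows.of_comp (LinearMap.funLeft ℝ* ℝ* g)
      exact (linearIndependent_equiv (Equiv.ofBijective e he)).mp hcomp
    rw [← hdet]
    exact det_mem_detE (fun i j => hA (f i) (g j)) fun i j => hY (e i) (g j)
  · intro s hs
    have hind : LinearIndependent ℝ* fun (i : {x // x ∈ s}) j => X i.1 j := by
      by_contra hdep
      exact hs ((linDepE_iff fun _ _ => hA _ _).mpr ⟨_, fun i j => hX i.1 j, hdep⟩)
    have hcard : (X.submatrix (Subtype.val : {x // x ∈ s} → Fin m) id).rank = s.card := by
      rw [LinearIndependent.rank_matrix (M := X.submatrix Subtype.val id) hind, Fintype.card_coe]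
    rw [← hcard, ← hrank]
    exact Matrix.rank_submatrix_le _ _ _
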